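/- For every integer n = 2k+1 with k ≥ 2 and all positive integers p, q, the p×q rectangle admits a rational-weighted signed tiling by T_n if and only if n divides p or n divides q. -/

import Mathlib

open scoped BigOperators Classical

/-- Translate a tile (a set of cells in `ℤ × ℤ`) by a vector `v`. -/
def tileTranslate (v : ℤ × ℤ) (T : Set (ℤ × ℤ)) : Set (ℤ × ℤ) := (fun c => v + c) '' T

/-- The ribbon L `n`-omino `T1 = {(0,j) : 0 ≤ j ≤ n-2} ∪ {(1,0)}`. -/
def T1 (n : ℕ) : Set (ℤ × ℤ) :=
  {c | c.1 = 0 ∧ 0 ≤ c.2 ∧ c.2 ≤ (n : ℤ) - 2} ∪ {((1 : ℤ), (0 : ℤ))}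

/-- The ribbon L `n`-omino `T2 = {(0,n-2)} ∪ {(1,j) : 0 ≤ j ≤ n-2}`. -/
def T2 (n : ℕ) : Set (ℤ × ℤ) :=
  {((0 : ℤ), (n : ℤ) - 2)} ∪ {c | c.1 = 1 ∧ 0 ≤ c.2 ∧ c.2 ≤ (n : ℤ) - 2}

/-- The ribbon L `n`-omino `T3 = {(i,0) : 0 ≤ i ≤ n-2} ∪ {(0,1)}`. -/
def T3 (n : ℕ) : Set (ℤ × ℤ) :=
  {c | c.2 = 0 ∧ 0 ≤ c.1 ∧ c.1 ≤ (n : ℤ) - 2} ∪ {((0 : ℤ), (1 : ℤ))}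

/-- The ribbon L `n`-omino `T4 = {(i,1) : 0 ≤ i ≤ n-2} ∪ {(n-2,0)}`. -/
def T4 (n : ℕ) : Set (ℤ × ℤ) :=
  {c | c.2 = 1 ∧ 0 ≤ c.1 ∧ c.1 ≤ (n : ℤ) - 2} ∪ {(((n : ℤ) - 2), (0 : ℤ))}

/-- The tile set `T_n` of the four ribbon L `n`-ominoes. -/
def TileSet (n : ℕ) : Set (Set (ℤ × ℤ)) := {T1 n, T2 n, T3 n, T4 n}

/-- `w` is a signed tiling of the region `R` by the tile set `tiles`:
a finitely supported integer weight on placements `(T, v)`, supported on placements of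
tiles from `tiles`, such that for each cell the weights of placements covering it sum to
`1` inside `R` and `0` outside. -/
def IsSignedTiling (tiles : Set (Set (ℤ × ℤ))) (R : Set (ℤ × ℤ))
    (w : Set (ℤ × ℤ) × (ℤ × ℤ) → ℤ) : Prop :=
  (Function.support w).Finite ∧
  (∀ p, w p ≠ 0 → p.1 ∈ tiles) ∧
  ∀ c : ℤ × ℤ,
    (∑ᶠ p ∈ {p : Set (ℤ × ℤ) × (ℤ × ℤ) | c ∈ tileTranslate p.2 p.1}, w p) =
      if c ∈ R then 1 else 0

/-- `P` is a (regular) tiling of the region `R` by the tile set `tiles`: a finite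
collection of placements of tiles from `tiles` whose translated copies are pairwise
disjoint and cover exactly `R`. -/
def IsTiling (tiles : Set (Set (ℤ × ℤ))) (R : Set (ℤ × ℤ))
    (P : Finset (Set (ℤ × ℤ) × (ℤ × ℤ))) : Prop :=
  (∀ p ∈ P, p.1 ∈ tiles) ∧
  (∀ p ∈ P, ∀ q ∈ P, p ≠ q → Disjoint (tileTranslate p.2 p.1) (tileTranslate q.2 q.1)) ∧
  (⋃ p ∈ P, tileTranslate p.2 p.1) = R

/-- The `p × q` rectangle (height `p`, base `q`) with lower-left corner at the origin. -/
def Rect (p q : ℕ) : Set (ℤ × ℤ) :=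
  {c | 0 ≤ c.1 ∧ c.1 ≤ (q : ℤ) - 1 ∧ 0 ≤ c.2 ∧ c.2 ≤ (p : ℤ) - 1}

/-- `w` is a rational-weighted signed tiling of the region `R` by the tile set `tiles`. -/
def IsRatSignedTiling (tiles : Set (Set (ℤ × ℤ))) (R : Set (ℤ × ℤ))
    (w : Set (ℤ × ℤ) × (ℤ × ℤ) → ℚ) : Prop :=
  (Function.support w).Finite ∧
  (∀ p, w p ≠ 0 → p.1 ∈ tiles) ∧
  ∀ c : ℤ × ℤ,
    (∑ᶠ p ∈ {p : Set (ℤ × ℤ) × (ℤ × ℤ) | c ∈ tileTranslate p.2 p.1}, w p) =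
      if c ∈ R then 1 else 0

/-- The relations expressing that the sum of `g` over every translate of `T1` and of `T2`
vanishes, for `n = 2 * k + 1`. -/
def VerticalRel {N : Type*} [AddCommGroup N] (k : ℕ) (g : ℤ × ℤ → N) : Prop :=
  (∀ a b : ℤ, ∑ j ∈ Finset.range (2 * k), g (a, b + j) + g (a + 1, b) = 0) ∧
  (∀ a b : ℤ, g (a, b + (2 * k - 1)) + ∑ j ∈ Finset.range (2 * k), g (a + 1, b + j) = 0)

section CellSums

variable {N : Type*} [AddCommGroup N]

theorem tileTranslate_T1 (k : ℕ) (v : ℤ × ℤ) :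
    tileTranslate v (T1 (2 * k + 1)) =
      ((fun j : ℕ => (v.1, v.2 + (j : ℤ))) '' (Finset.range (2 * k) : Set ℕ)) ∪
        {(v.1 + 1, v.2)} := by
  ext ⟨x, y⟩
  simp only [tileTranslate, T1, Set.mem_image, Set.mem_union, Set.mem_ofPred_eq,
    Set.mem_singleton_iff, Finset.coe_range, Set.mem_Iio, Prod.ext_iff, Prod.exists,
    Prod.fst_add, Prod.snd_add]
  constructor
  · rintro ⟨a, b, h, h'⟩
    rcases h with h | h
    · exact Or.inl ⟨b.toNat, by omega, by omega, by omega⟩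
    · exact Or.inr (by omega)
  · rintro (⟨j, h, h'⟩ | h)
    · exact ⟨0, j, Or.inl (by omega), by omega⟩
    · exact ⟨1, 0, Or.inr (by omega), by omega⟩

theorem tileTranslate_T2 (k : ℕ) (v : ℤ × ℤ) :
    tileTranslate v (T2 (2 * k + 1)) =
      {(v.1, v.2 + (2 * k - 1))} ∪
      ((fun j : ℕ => (v.1 + 1, v.2 + (j : ℤ))) '' (Finset.range (2 * k) : Set ℕ)) := by
  ext ⟨x, y⟩
  simp only [tileTranslate, T2, Set.mem_image, Set.mem_union, Set.mem_ofPred_eq,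
    Set.mem_singleton_iff, Finset.coe_range, Set.mem_Iio, Prod.ext_iff, Prod.exists,
    Prod.fst_add, Prod.snd_add]
  constructor
  · rintro ⟨a, b, h, h'⟩
    rcases h with h | h
    · exact Or.inl (by omega)
    · exact Or.inr ⟨b.toNat, by omega, by omega, by omega⟩
  · rintro (h | ⟨j, h, h'⟩)
    · exact ⟨0, 2 * k - 1, Or.inl (by omega), by omega⟩
    · exact ⟨1, j, Or.inr (by omega), by omega⟩

theorem T3_eq_swap_image (n : ℕ) : T3 n = Prod.swap '' T1 n := by
  ext ⟨x, y⟩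
  simp only [T3, T1, Set.image_swap_eq_preimage_swap, Set.mem_preimage, Set.mem_union,
    Set.mem_ofPred_eq, Set.mem_singleton_iff, Prod.swap_prod_mk, Prod.ext_iff]
  tauto

theorem T4_eq_swap_image (n : ℕ) : T4 n = Prod.swap '' T2 n := by
  ext ⟨x, y⟩
  simp only [T4, T2, Set.image_swap_eq_preimage_swap, Set.mem_preimage, Set.mem_union,
    Set.mem_ofPred_eq, Set.mem_singleton_iff, Prod.swap_prod_mk, Prod.ext_iff]
  tauto

theorem tileTranslate_swap_image (v : ℤ × ℤ) (T : Set (ℤ × ℤ)) :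
    tileTranslate v (Prod.swap '' T) = Prod.swap '' tileTranslate v.swap T := by
  simp only [tileTranslate, Set.image_image, Prod.swap_add, Prod.swap_swap]

theorem finite_tileTranslate {k : ℕ} {T : Set (ℤ × ℤ)} (hT : T ∈ TileSet (2 * k + 1))
    (v : ℤ × ℤ) : (tileTranslate v T).Finite := by
  have h₁ (v) : (tileTranslate v (T1 (2 * k + 1))).Finite := by
    rw [tileTranslate_T1]
    exact ((Finset.finite_toSet _).image _).union (Set.finite_singleton _)
  have h₂ (v) : (tileTranslate v (T2 (2 * k + 1))).Finite := by
    rw [tileTranslate_T2]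
    exact (Set.finite_singleton _).union ((Finset.finite_toSet _).image _)
  rcases hT with rfl | rfl | rfl | rfl
  · exact h₁ v
  · exact h₂ v
  · rw [T3_eq_swap_image, tileTranslate_swap_image]
    exact (h₁ _).image _
  · rw [T4_eq_swap_image, tileTranslate_swap_image]
    exact (h₂ _).image _

theorem finsum_mem_column (g : ℤ × ℤ → N) (m : ℕ) (a b : ℤ) :
    ∑ᶠ c ∈ (fun j : ℕ => (a, b + (j : ℤ))) '' (Finset.range m : Set ℕ), g c =
      ∑ j ∈ Finset.range m, g (a, b + j) := by
  rw [finsum_mem_image, finsum_mem_coe_finset]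
  intro i _ j _ h
  simpa using h

theorem finsum_mem_T1 (g : ℤ × ℤ → N) (k : ℕ) (v : ℤ × ℤ) :
    ∑ᶠ c ∈ tileTranslate v (T1 (2 * k + 1)), g c =
      ∑ j ∈ Finset.range (2 * k), g (v.1, v.2 + j) + g (v.1 + 1, v.2) := by
  rw [tileTranslate_T1, finsum_mem_union _ ((Finset.finite_toSet _).image _)
    (Set.finite_singleton _), finsum_mem_column, finsum_mem_singleton]
  simp [Set.disjoint_singleton_right]

theorem finsum_mem_T2 (g : ℤ × ℤ → N) (k : ℕ) (v : ℤ × ℤ) :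
    ∑ᶠ c ∈ tileTranslate v (T2 (2 * k + 1)), g c =
      g (v.1, v.2 + (2 * k - 1)) + ∑ j ∈ Finset.range (2 * k), g (v.1 + 1, v.2 + j) := by
  rw [tileTranslate_T2, finsum_mem_union _ (Set.finite_singleton _)
    ((Finset.finite_toSet _).image _), finsum_mem_column, finsum_mem_singleton]
  simp [Set.disjoint_singleton_left]

theorem finsum_mem_tileTranslate_swap_image (g : ℤ × ℤ → N) (v : ℤ × ℤ) (T : Set (ℤ × ℤ)) :
    ∑ᶠ c ∈ tileTranslate v (Prod.swap '' T), g c =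
      ∑ᶠ c ∈ tileTranslate v.swap T, g c.swap := by
  rw [tileTranslate_swap_image, finsum_mem_image Prod.swap_injective.injOn]

theorem forall_tile_finsum_eq_zero_iff (k : ℕ) (g : ℤ × ℤ → N) :
    (∀ T ∈ TileSet (2 * k + 1), ∀ v, ∑ᶠ c ∈ tileTranslate v T, g c = 0) ↔
      VerticalRel k g ∧ VerticalRel k (fun c => g c.swap) := by
  simp only [TileSet, Set.mem_insert_iff, Set.mem_singleton_iff, forall_eq_or_imp, forall_eq,
    T3_eq_swap_image, T4_eq_swap_image, finsum_mem_tileTranslate_swap_image, finsum_mem_T1,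
    finsum_mem_T2 g, finsum_mem_T2 (fun c => g c.swap), VerticalRel, Prod.forall,
    Prod.swap_prod_mk]
  exact ⟨fun ⟨h₁, h₂, h₃, h₄⟩ => ⟨⟨h₁, h₂⟩, fun a b => h₃ b a, fun a b => h₄ b a⟩,
    fun ⟨⟨h₁, h₂⟩, h₃, h₄⟩ => ⟨h₁, h₂, fun a b => h₃ b a, fun a b => h₄ b a⟩⟩

theorem rect_eq_image (p q : ℕ) :
    Rect p q = (fun c : ℕ × ℕ => ((c.1 : ℤ), (c.2 : ℤ))) ''
      (Finset.range q ×ˢ Finset.range p : Finset (ℕ × ℕ)) := by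
  ext ⟨x, y⟩
  simp only [Rect, Set.mem_ofPred_eq, Finset.coe_product, Finset.coe_range, Set.mem_image,
    Set.mem_prod, Set.mem_Iio, Prod.exists, Prod.ext_iff]
  constructor
  · intro h
    exact ⟨x.toNat, y.toNat, by omega, by omega⟩
  · rintro ⟨i, j, h, h'⟩
    omega

theorem finite_rect (p q : ℕ) : (Rect p q).Finite := by
  rw [rect_eq_image]
  exact (Finset.finite_toSet _).image _

theorem finsum_mem_rect (g : ℤ × ℤ → N) (p q : ℕ) :
    ∑ᶠ c ∈ Rect p q, g c = ∑ i ∈ Finset.range q, ∑ j ∈ Finset.range p, g (i, j) := by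
  rw [rect_eq_image, finsum_mem_image, finsum_mem_coe_finset, Finset.sum_product]
  rintro ⟨_, _⟩ _ ⟨_, _⟩ _ h
  simpa using h

end CellSums

section Bars

variable {N : Type*} [AddCommGroup N] {k : ℕ} {g : ℤ × ℤ → N}

theorem VerticalRel.knight (h : VerticalRel k g) (a b : ℤ) :
    g (a, b + (2 * k - 1)) = g (a + 2, b) := by
  have h₁ := h.1 (a + 1) b
  have h₂ := h.2 a b
  rw [add_assoc a 1 1, one_add_one_eq_two] at h₁
  rw [eq_neg_of_add_eq_zero_left h₂, eq_neg_of_add_eq_zero_right h₁]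

/-- The diagonal differences `g (a + 1, b + 1) - g (a, b)` are antiperiodic in `a`. -/
theorem VerticalRel.diagonal_antiperiodic (h : VerticalRel k g) (a b : ℤ) :
    g (a + 1 + 1, b + 1) - g (a + 1, b) = -(g (a + 1, b + 1) - g (a, b)) := by
  have h₁ := h.1 a b
  have h₂ := h.1 a (b + 1)
  have h₃ := Finset.sum_range_succ' (fun j : ℕ => g (a, b + j)) (2 * k)
  rw [Finset.sum_range_succ] at h₃
  have h₄ := h.knight a (b + 1)
  rw [show b + 1 + (2 * (k : ℤ) - 1) = b + (2 * k : ℕ) by push_cast; ring] at h₄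
  have h₅ : ∑ j ∈ Finset.range (2 * k), g (a, b + (j + 1 : ℕ)) =
      ∑ j ∈ Finset.range (2 * k), g (a, b + 1 + j) :=
    Finset.sum_congr rfl fun j _ => by
      rw [show b + ((j + 1 : ℕ) : ℤ) = b + 1 + j by push_cast; ring]
  rw [h₅, h₄, eq_neg_of_add_eq_zero_left h₁, eq_neg_of_add_eq_zero_left h₂] at h₃
  simp only [Nat.cast_zero, add_zero] at h₃
  rw [add_assoc a 1 1, one_add_one_eq_two, ← sub_eq_zero]
  rw [← sub_eq_zero] at h₃
  rw [← h₃]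
  abel

theorem sum_range_two_mul_antiperiodic {e : ℤ → N} (he : ∀ a, e (a + 1) = -e a) (a : ℤ)
    (m : ℕ) : ∑ i ∈ Finset.range (2 * m), e (a + i) = 0 := by
  induction m with
  | zero => simp
  | succ m ih =>
    rw [show 2 * (m + 1) = 2 * m + 1 + 1 by ring, Finset.sum_range_succ, Finset.sum_range_succ,
      ih, zero_add, show a + ((2 * m + 1 : ℕ) : ℤ) = a + (2 * m : ℕ) + 1 by push_cast; ring, he,
      add_neg_cancel]

theorem VerticalRel.diagonal (h : VerticalRel k g) (h' : VerticalRel k (fun c => g c.swap))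
    (a b : ℤ) : g (a + 1, b + 1) = g (a, b) := by
  have h₁ := sum_range_two_mul_antiperiodic
    (e := fun b => g (a + 1, b + 1) - g (a, b)) (fun b => h'.diagonal_antiperiodic b a) b k
  have h₂ := h.1 a b
  have h₃ := h.1 (a + 1) (b + 1)
  have h₄ := h.diagonal_antiperiodic a b
  have h₅ : ∑ j ∈ Finset.range (2 * k), g (a + 1, b + j + 1) =
      ∑ j ∈ Finset.range (2 * k), g (a + 1, b + 1 + j) :=
    Finset.sum_congr rfl fun j _ => by rw [add_right_comm]
  rw [Finset.sum_sub_distrib, h₅, eq_neg_of_add_eq_zero_left h₂,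
    eq_neg_of_add_eq_zero_left h₃] at h₁
  rw [← sub_eq_zero, ← neg_eq_zero, ← h₄, ← neg_eq_zero, ← h₁]
  abel

/-- Every `n × 1` bar is annihilated, for `n = 2 * k + 1`. -/
theorem VerticalRel.bar (h : VerticalRel k g) (h' : VerticalRel k (fun c => g c.swap))
    (a b : ℤ) : ∑ j ∈ Finset.range (2 * k + 1), g (a, b + j) = 0 := by
  have h₁ := h.knight a (b + 1)
  rw [show b + 1 + (2 * (k : ℤ) - 1) = b + (2 * k : ℕ) by push_cast; ring] at h₁
  have h₂ := h.diagonal h' (a + 1) b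
  rw [add_assoc a 1 1, one_add_one_eq_two] at h₂
  rw [Finset.sum_range_succ, h₁, h₂, h.1 a b]

theorem VerticalRel.column (h : VerticalRel k g) (h' : VerticalRel k (fun c => g c.swap))
    (a : ℤ) {p : ℕ} (hp : 2 * k + 1 ∣ p) : ∑ j ∈ Finset.range p, g (a, j) = 0 := by
  obtain ⟨m, rfl⟩ := hp
  induction m with
  | zero => simp
  | succ m ih =>
    rw [mul_add, mul_one, Finset.sum_range_add, ih, zero_add]
    simpa using h.bar h' a ((2 * k + 1) * m : ℕ)

theorem VerticalRel.rect (h : VerticalRel k g) (h' : VerticalRel k (fun c => g c.swap))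
    {p q : ℕ} (hpq : 2 * k + 1 ∣ p ∨ 2 * k + 1 ∣ q) : ∑ᶠ c ∈ Rect p q, g c = 0 := by
  rw [finsum_mem_rect]
  rcases hpq with hp | hq
  · exact Finset.sum_eq_zero fun i _ => h.column h' i hp
  · rw [Finset.sum_comm]
    exact Finset.sum_eq_zero fun j _ => h'.column h j hq

end Bars

section Spans

/-- The formal sum of the cells of a region. -/
noncomputable def cellSum (A : Set (ℤ × ℤ)) : ℤ × ℤ →₀ ℚ :=
  ∑ᶠ c ∈ A, Finsupp.single c (1 : ℚ)

theorem map_cellSum {N : Type*} [AddCommGroup N] [Module ℚ N] (φ : (ℤ × ℤ →₀ ℚ) →ₗ[ℚ] N)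
    {A : Set (ℤ × ℤ)} (hA : A.Finite) :
    φ (cellSum A) = ∑ᶠ c ∈ A, φ (Finsupp.single c 1) :=
  φ.toAddMonoidHom.map_finsum_mem _ hA

theorem cellSum_apply {A : Set (ℤ × ℤ)} (hA : A.Finite) (c : ℤ × ℤ) :
    cellSum A c = if c ∈ A then 1 else 0 := by
  have h := map_cellSum (Finsupp.lapply c) hA
  rw [Finsupp.lapply_apply] at h
  rw [h, finsum_mem_eq_finite_toFinset_sum _ hA]
  simp [Finsupp.single_apply]

/-- The span of all translates of the four ribbon tiles. -/
noncomputable def tileSpan (k : ℕ) : Submodule ℚ (ℤ × ℤ →₀ ℚ) :=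
  Submodule.span ℚ ((fun p : Set (ℤ × ℤ) × (ℤ × ℤ) => cellSum (tileTranslate p.2 p.1)) ''
    {p | p.1 ∈ TileSet (2 * k + 1)})

theorem linearCombination_cellSum_apply {k : ℕ} {l : Set (ℤ × ℤ) × (ℤ × ℤ) →₀ ℚ}
    (hl : ∀ p, l p ≠ 0 → p.1 ∈ TileSet (2 * k + 1)) (c : ℤ × ℤ) :
    Finsupp.linearCombination ℚ
        (fun p : Set (ℤ × ℤ) × (ℤ × ℤ) => cellSum (tileTranslate p.2 p.1)) l c =
      ∑ᶠ p ∈ {p : Set (ℤ × ℤ) × (ℤ × ℤ) | c ∈ tileTranslate p.2 p.1}, l p := by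
  rw [Finsupp.linearCombination_apply, Finsupp.sum, Finsupp.finsetSum_apply, finsum_mem_def,
    finsum_eq_sum_of_support_subset (s := l.support)]
  · refine Finset.sum_congr rfl fun p hp => ?_
    rw [Finsupp.smul_apply, cellSum_apply (finite_tileTranslate (hl p (by simpa using hp)) _),
      Set.indicator_apply]
    simp
  · intro p hp
    simp only [Function.mem_support, Set.indicator_apply_ne_zero] at hp
    simpa using hp.2

theorem exists_isRatSignedTiling_iff {k : ℕ} {R : Set (ℤ × ℤ)} (hR : R.Finite) :
    (∃ w, IsRatSignedTiling (TileSet (2 * k + 1)) R w) ↔ cellSum R ∈ tileSpan k := by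
  rw [tileSpan, Finsupp.mem_span_image_iff_linearCombination]
  constructor
  · rintro ⟨w, hfin, hw, hsum⟩
    let l := Finsupp.ofSupportFinite w hfin
    have hl : ∀ p, l p ≠ 0 → p.1 ∈ TileSet (2 * k + 1) := hw
    refine ⟨l, fun p hp => hl p (by simpa using hp), ?_⟩
    ext c
    rw [linearCombination_cellSum_apply hl, cellSum_apply hR]
    exact hsum c
  · rintro ⟨l, hl, hsum⟩
    have hl' : ∀ p, l p ≠ 0 → p.1 ∈ TileSet (2 * k + 1) := fun p hp => hl (by simpa using hp)
    refine ⟨l, l.hasFiniteSupport, hl', fun c => ?_⟩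
    rw [← linearCombination_cellSum_apply hl', hsum, cellSum_apply hR]

theorem map_cellSum_eq_zero_of_mem_tileSpan {k : ℕ} {N : Type*} [AddCommGroup N] [Module ℚ N]
    {g : ℤ × ℤ → N} (h : VerticalRel k g) (h' : VerticalRel k (fun c => g c.swap))
    {R : Set (ℤ × ℤ)} (hR : R.Finite) (hmem : cellSum R ∈ tileSpan k) :
    ∑ᶠ c ∈ R, g c = 0 := by
  have hle : tileSpan k ≤ LinearMap.ker (Finsupp.linearCombination ℚ g) := by
    rw [tileSpan, Submodule.span_le]
    rintro _ ⟨⟨T, v⟩, hT, rfl⟩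
    have := (forall_tile_finsum_eq_zero_iff k g).2 ⟨h, h'⟩ T hT v
    simpa [map_cellSum _ (finite_tileTranslate hT v)] using this
  simpa [map_cellSum _ hR] using hle hmem

theorem cellSum_mem_tileSpan_of_dvd {k p q : ℕ} (hpq : 2 * k + 1 ∣ p ∨ 2 * k + 1 ∣ q) :
    cellSum (Rect p q) ∈ tileSpan k := by
  obtain ⟨h, h'⟩ := (forall_tile_finsum_eq_zero_iff k
    (fun c => (tileSpan k).mkQ (Finsupp.single c 1))).1 fun T hT v => by
      rw [← map_cellSum _ (finite_tileTranslate hT v), Submodule.mkQ_apply,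
        Submodule.Quotient.mk_eq_zero]
      exact Submodule.subset_span ⟨(T, v), hT, rfl⟩
  have := h.rect h' hpq
  rwa [← map_cellSum _ (finite_rect p q), Submodule.mkQ_apply,
    Submodule.Quotient.mk_eq_zero] at this

end Spans

section RootsOfUnity

theorem verticalRel_zpow {k : ℕ} {z : ℂ} (hz : z ≠ 0)
    (hsum : ∑ j ∈ Finset.range (2 * k + 1), z ^ j = 0) :
    VerticalRel k (fun c : ℤ × ℤ => z ^ (c.2 - c.1)) := by
  constructor
  · intro a b
    rw [Finset.sum_range_succ'] at hsum
    have h : ∑ j ∈ Finset.range (2 * k), z ^ (b + j - a) =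
        z ^ (b - (a + 1)) * ∑ j ∈ Finset.range (2 * k), z ^ (j + 1) := by
      rw [Finset.mul_sum]
      refine Finset.sum_congr rfl fun j _ => ?_
      rw [← zpow_natCast, ← zpow_add₀ hz]
      congr 1
      push_cast
      ring
    simp only [h]
    linear_combination z ^ (b - (a + 1)) * hsum
  · intro a b
    rw [Finset.sum_range_succ] at hsum
    have h : ∑ j ∈ Finset.range (2 * k), z ^ (b + j - (a + 1)) =
        z ^ (b - (a + 1)) * ∑ j ∈ Finset.range (2 * k), z ^ j := by
      rw [Finset.mul_sum]
      refine Finset.sum_congr rfl fun j _ => ?_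
      rw [← zpow_natCast, ← zpow_add₀ hz]
      congr 1
      ring
    have h' : z ^ (b + (2 * k - 1) - a) = z ^ (b - (a + 1)) * z ^ (2 * k) := by
      rw [← zpow_natCast, ← zpow_add₀ hz]
      congr 1
      push_cast
      ring
    simp only [h, h']
    linear_combination z ^ (b - (a + 1)) * hsum

theorem IsPrimitiveRoot.dvd_of_geom_sum_eq_zero {n m : ℕ} {z : ℂ} (hz : IsPrimitiveRoot z n)
    (h : ∑ j ∈ Finset.range m, z ^ j = 0) : n ∣ m := by
  refine hz.dvd_of_pow_eq_one m (sub_eq_zero.1 ?_)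
  rw [← geom_sum_mul, h, zero_mul]

theorem dvd_of_cellSum_mem_tileSpan {k p q : ℕ} (hk : k ≠ 0)
    (hmem : cellSum (Rect p q) ∈ tileSpan k) : 2 * k + 1 ∣ p ∨ 2 * k + 1 ∣ q := by
  obtain ⟨z, hz⟩ : ∃ z : ℂ, IsPrimitiveRoot z (2 * k + 1) :=
    ⟨_, Complex.isPrimitiveRoot_exp _ (Nat.succ_ne_zero _)⟩
  have hz₀ : z ≠ 0 := hz.ne_zero (Nat.succ_ne_zero _)
  have h := verticalRel_zpow hz₀ (hz.geom_sum_eq_zero (by omega))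
  have h' : VerticalRel k (fun c : ℤ × ℤ => z ^ (c.swap.2 - c.swap.1)) := by
    convert verticalRel_zpow (inv_ne_zero hz₀) (hz.inv.geom_sum_eq_zero (by omega)) using 2 with c
    rw [inv_zpow', neg_sub, Prod.snd_swap, Prod.fst_swap]
  have hzero := map_cellSum_eq_zero_of_mem_tileSpan h h' (finite_rect p q) hmem
  have hprod : (∑ i ∈ Finset.range q, z⁻¹ ^ i) * ∑ j ∈ Finset.range p, z ^ j = 0 := by
    rw [← hzero, finsum_mem_rect, Finset.sum_mul_sum]
    refine Finset.sum_congr rfl fun i _ => Finset.sum_congr rfl fun j _ => ?_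
    rw [zpow_sub₀ hz₀, zpow_natCast, zpow_natCast, inv_pow, div_eq_mul_inv, mul_comm]
  rcases mul_eq_zero.1 hprod with hq | hp
  · exact Or.inr (hz.inv.dvd_of_geom_sum_eq_zero hq)
  · exact Or.inl (hz.dvd_of_geom_sum_eq_zero hp)

end RootsOfUnity

/-- For every integer `n = 2k+1` with `k ≥ 2` and all positive integers `p, q`, the
`p × q` rectangle admits a rational-weighted signed tiling by `T_n` iff `n ∣ p` or
`n ∣ q`. -/
theorem rect_rat_signed_tiling_iff_side_div (k : ℕ) (hk : 2 ≤ k) (p q : ℕ)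
    (hp : 0 < p) (hq : 0 < q) :
    (∃ w, IsRatSignedTiling (TileSet (2 * k + 1)) (Rect p q) w) ↔
      (2 * k + 1) ∣ p ∨ (2 * k + 1) ∣ q := by
  rw [exists_isRatSignedTiling_iff (finite_rect p q)]
  exact ⟨dvd_of_cellSum_mem_tileSpan (by omega), cellSum_mem_tileSpan_of_dvd⟩
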